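/- Let L be a finite semidistrim lattice with unique pairing κ_L and rowmotion Row_L. For every x ∈ L: Row_L(x) = ⋀ κ_L(D_L(x)) and Row_L⁻¹(x) = ⋁ U_L(x); moreover Pop↓(x) = x ∧ ⋀ κ_L(D_L(x)) and Pop↑(x) = x ∨ ⋁ U_L(x). In particular, Pop↓(x) = x ∧ Row_L(x) and Pop↑(x) = x ∨ Row_L⁻¹(x). -/

import Mathlib

universe u

/-- An element of a lattice is join-irreducible if it covers exactly one element. -/
def JoinIrred {α : Type u} [Lattice α] (j : α) : Prop := ∃! y : α, y ⋖ j

/-- An element of a lattice is meet-irreducible if it is covered by exactly one element. -/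
def MeetIrred {α : Type u} [Lattice α] (m : α) : Prop := ∃! y : α, m ⋖ y

/-- `j` is join-prime if `j ≤ x ⊔ y` implies `j ≤ x` or `j ≤ y`. -/
def JoinPrime {α : Type u} [Lattice α] (j : α) : Prop :=
  ∀ x y : α, j ≤ x ⊔ y → j ≤ x ∨ j ≤ y

/-- `m` is meet-prime if `x ⊓ y ≤ m` implies `x ≤ m` or `y ≤ m`. -/
def MeetPrime {α : Type u} [Lattice α] (m : α) : Prop :=
  ∀ x y : α, x ⊓ y ≤ m → x ≤ m ∨ y ≤ m

/-- `(j0, m0)` is a prime pair: the lattice is the disjoint union of `[⊥, m0]` and `[j0, ⊤]`,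
i.e. every element satisfies exactly one of `z ≤ m0` or `j0 ≤ z`. -/
def IsPrimePair {α : Type u} [Lattice α] (j0 m0 : α) : Prop :=
  ∀ z : α, (z ≤ m0 ∨ j0 ≤ z) ∧ ¬(z ≤ m0 ∧ j0 ≤ z)

/-- A pairing is a bijection `κ` from join-irreducibles to meet-irreducibles such that
`κ j` is maximal in `{z | j ⊓ z = j_*}` and `j = κ⁻¹ (κ j)` is minimal in
`{z | κ j ⊔ z = (κ j)^*}`. -/
def IsPairing {α : Type u} [Lattice α]
    (κ : {j : α // JoinIrred j} → {m : α // MeetIrred m}) : Prop :=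
  Function.Bijective κ ∧
    (∀ (j : {j : α // JoinIrred j}) (jst : α), jst ⋖ j.1 →
      Maximal (fun z : α => j.1 ⊓ z = jst) (κ j).1) ∧
    (∀ (j : {j : α // JoinIrred j}) (mst : α), (κ j).1 ⋖ mst →
      Minimal (fun z : α => (κ j).1 ⊔ z = mst) j.1)

/-- The edge relation of the Galois graph: `j → j'` iff `j ≠ j'` and `j ≰ κ j'`. -/
def GaloisEdge {α : Type u} [Lattice α]
    (κ : {j : α // JoinIrred j} → {m : α // MeetIrred m})
    (j j' : {j : α // JoinIrred j}) : Prop :=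
  j ≠ j' ∧ ¬ j.1 ≤ (κ j').1

/-- Independent sets of the Galois graph (no edge in either direction). -/
def IndepSet {α : Type u} [Lattice α]
    (κ : {j : α // JoinIrred j} → {m : α // MeetIrred m})
    (S : Set {j : α // JoinIrred j}) : Prop :=
  ∀ j ∈ S, ∀ j' ∈ S, ¬ GaloisEdge κ j j'

/-- The downward label set `D_L(x)`: labels of the cover relations `y ⋖ x`. -/
def DLabel {α : Type u} [Lattice α]
    (κ : {j : α // JoinIrred j} → {m : α // MeetIrred m}) (x : α) :
    Set {j : α // JoinIrred j} :=
  {j | ∃ y : α, y ⋖ x ∧ j.1 ≤ x ∧ y ≤ (κ j).1}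

/-- The upward label set `U_L(x)`: labels of the cover relations `x ⋖ y`. -/
def ULabel {α : Type u} [Lattice α]
    (κ : {j : α // JoinIrred j} → {m : α // MeetIrred m}) (x : α) :
    Set {j : α // JoinIrred j} :=
  {j | ∃ y : α, x ⋖ y ∧ j.1 ≤ y ∧ x ≤ (κ j).1}

/-- A uniquely paired lattice is overlapping if every cover relation has a unique label. -/
def Overlapping {α : Type u} [Lattice α]
    (κ : {j : α // JoinIrred j} → {m : α // MeetIrred m}) : Prop :=
  ∀ x y : α, x ⋖ y → ∃! j : {j : α // JoinIrred j}, j.1 ≤ y ∧ x ≤ (κ j).1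

/-- Compatibly dismantlable lattices: either a one-element lattice, or a uniquely paired
lattice with a prime pair `(j0, m0)` whose intervals `[j0, ⊤] = Set.Ici j0` and
`[⊥, m0] = Set.Iic m0` are compatibly dismantlable, together with the compatibility
conditions relating the unique pairings via `α j = j0 ⊔ j` and `β m = m0 ⊓ m`. -/
inductive CompatiblyDismantlable : (β : Type u) → [Lattice β] → [Finite β] → Prop
  | singleton (β : Type u) [Lattice β] [Finite β] (h : Nat.card β = 1) :
      CompatiblyDismantlable β
  | step (β : Type u) [Lattice β] [Finite β]
      (κ : {j : β // JoinIrred j} → {m : β // MeetIrred m})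
      (hκ : IsPairing κ) (huniq : ∀ κ', IsPairing κ' → κ' = κ)
      (j0 m0 : β) (hpp : IsPrimePair j0 m0)
      (hup : CompatiblyDismantlable ↥(Set.Ici j0))
      (hdn : CompatiblyDismantlable ↥(Set.Iic m0))
      (κup : {j : ↥(Set.Ici j0) // JoinIrred j} → {m : ↥(Set.Ici j0) // MeetIrred m})
      (hκup : IsPairing κup) (hκupuniq : ∀ κ', IsPairing κ' → κ' = κup)
      (κdn : {j : ↥(Set.Iic m0) // JoinIrred j} → {m : ↥(Set.Iic m0) // MeetIrred m})
      (hκdn : IsPairing κdn) (hκdnuniq : ∀ κ', IsPairing κ' → κ' = κdn)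
      (halpha : ∀ j : {j : β // JoinIrred j}, j0 ≤ (κ j).1 →
          ∃ hji : JoinIrred (⟨j0 ⊔ j.1, Set.mem_Ici.mpr le_sup_left⟩ : ↥(Set.Ici j0)),
            (κup ⟨⟨j0 ⊔ j.1, Set.mem_Ici.mpr le_sup_left⟩, hji⟩).1.1 = (κ j).1)
      (halphainj : ∀ j j' : {j : β // JoinIrred j}, j0 ≤ (κ j).1 → j0 ≤ (κ j').1 →
          j0 ⊔ j.1 = j0 ⊔ j'.1 → j = j')
      (halphasurj : ∀ j' : {j : ↥(Set.Ici j0) // JoinIrred j},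
          ∃ j : {j : β // JoinIrred j}, j0 ≤ (κ j).1 ∧ j0 ⊔ j.1 = j'.1.1)
      (hbeta : ∀ (j : {j : β // JoinIrred j}) (h : j.1 ≤ m0),
          ∃ hji : JoinIrred (⟨j.1, Set.mem_Iic.mpr h⟩ : ↥(Set.Iic m0)),
            (κdn ⟨⟨j.1, Set.mem_Iic.mpr h⟩, hji⟩).1.1 = m0 ⊓ (κ j).1)
      (hbetainj : ∀ j j' : {j : β // JoinIrred j}, j.1 ≤ m0 → j'.1 ≤ m0 →
          m0 ⊓ (κ j).1 = m0 ⊓ (κ j').1 → j = j')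
      (hbetasurj : ∀ m' : {m : ↥(Set.Iic m0) // MeetIrred m},
          ∃ j : {j : β // JoinIrred j}, j.1 ≤ m0 ∧ m0 ⊓ (κ j).1 = m'.1.1) :
      CompatiblyDismantlable β

/-- A lattice is semidistrim if it is compatibly dismantlable and the downward and upward
label sets of every element are independent sets of the Galois graph. -/
def Semidistrim (β : Type u) [Lattice β] [Finite β] : Prop :=
  CompatiblyDismantlable β ∧
    ∀ κ : {j : β // JoinIrred j} → {m : β // MeetIrred m}, IsPairing κ →
      ∀ x : β, IndepSet κ (DLabel κ x) ∧ IndepSet κ (ULabel κ x)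

/-- The pop-stack sorting operator `Pop↓(x) = x ⊓ ⋀{y | y ⋖ x}`. -/
def PopDown {α : Type u} [CompleteLattice α] (x : α) : α := x ⊓ sInf {y : α | y ⋖ x}

/-- The dual pop-stack sorting operator `Pop↑(x) = x ⊔ ⋁{y | x ⋖ y}`. -/
def PopUp {α : Type u} [CompleteLattice α] (x : α) : α := x ⊔ sSup {y : α | x ⋖ y}

theorem exists_label {β : Type u} [Lattice β] [Finite β] (h : CompatiblyDismantlable β) :
    ∀ κ : {j : β // JoinIrred j} → {m : β // MeetIrred m}, IsPairing κ →
      ∀ x y : β, x ⋖ y → ∃ j : {j : β // JoinIrred j}, j.1 ≤ y ∧ x ≤ (κ j).1 := by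
  induction h with
  | singleton β h =>
    intro κ _ x y hxy
    have := (Nat.card_eq_one_iff_unique.mp h).1
    exact absurd (Subsingleton.elim x y) hxy.lt.ne
  | step β κ hκ huniq j0 m0 hpp hup hdn κup hκup hκupuniq κdn hκdn hκdnuniq halpha halphainj
      halphasurj hbeta hbetainj hbetasurj ihup ihdn =>
    intro κ' hκ' x y hxy
    obtain rfl := huniq κ' hκ'
    by_cases hx : j0 ≤ x
    · have hy : j0 ≤ y := hx.trans hxy.le
      have hc : (⟨x, hx⟩ : ↥(Set.Ici j0)) ⋖ ⟨y, hy⟩ :=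
        ⟨hxy.lt, fun z h1 h2 => hxy.2 (show x < z.1 from h1) h2⟩
      obtain ⟨j', h1, h2⟩ := ihup κup hκup _ _ hc
      obtain ⟨j, h3, h4⟩ := halphasurj j'
      obtain ⟨hji, h5⟩ := halpha j h3
      have e : (⟨⟨j0 ⊔ j.1, Set.mem_Ici.mpr le_sup_left⟩, hji⟩ :
          {j : ↥(Set.Ici j0) // JoinIrred j}) = j' := Subtype.ext (Subtype.ext h4)
      rw [e] at h5
      have h1' : j'.1.1 ≤ y := h1
      have h2' : x ≤ (κup j').1.1 := h2
      exact ⟨j, le_sup_right.trans (h4.le.trans h1'), h2'.trans h5.le⟩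
    · have hxm : x ≤ m0 := (hpp x).1.resolve_right hx
      by_cases hy : j0 ≤ y
      · have hlt : j0 ⊓ m0 < j0 :=
          lt_of_le_of_ne inf_le_left fun e => (hpp j0).2 ⟨inf_eq_left.mp e, le_rfl⟩
        have hbelow : ∀ z, z < j0 → z ≤ j0 ⊓ m0 := fun z hz =>
          le_inf hz.le ((hpp z).1.resolve_right fun h => absurd hz h.not_gt)
        have hcov : j0 ⊓ m0 ⋖ j0 := ⟨hlt, fun z h1 h2 => absurd h1 (hbelow z h2).not_gt⟩
        have hj : JoinIrred j0 := ⟨j0 ⊓ m0, hcov, fun z hz =>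
          (eq_or_lt_of_le (hbelow z hz.lt)).resolve_right fun h => hz.2 h hlt⟩
        have hmax := hκ'.2.1 ⟨j0, hj⟩ _ hcov
        have hk : (κ' ⟨j0, hj⟩).1 ≤ m0 := by
          refine (hpp _).1.resolve_right fun h => ?_
          have h6 : j0 ⊓ (κ' ⟨j0, hj⟩).1 = j0 ⊓ m0 := hmax.1
          rw [inf_eq_left.mpr h] at h6
          exact hlt.ne h6.symm
        exact ⟨⟨j0, hj⟩, hy, hxm.trans (hmax.2 rfl hk)⟩
      · have hym : y ≤ m0 := (hpp y).1.resolve_right hy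
        have hc : (⟨x, hxm⟩ : ↥(Set.Iic m0)) ⋖ ⟨y, hym⟩ :=
          ⟨hxy.lt, fun z h1 h2 => hxy.2 (show x < z.1 from h1) h2⟩
        obtain ⟨j', h1, h2⟩ := ihdn κdn hκdn _ _ hc
        obtain ⟨j, h3, h4⟩ := hbetasurj (κdn j')
        obtain ⟨hji, h5⟩ := hbeta j h3
        have e := hκdn.1.1 (Subtype.ext (Subtype.ext (h5.trans h4)))
        have h1' : j'.1.1 ≤ y := h1
        have h2' : x ≤ (κdn j').1.1 := h2
        rw [← e] at h1'
        exact ⟨j, h1', h2'.trans (h4.ge.trans inf_le_right)⟩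

theorem not_le_kappa {β : Type u} [Lattice β]
    {κ : {j : β // JoinIrred j} → {m : β // MeetIrred m}} (hκ : IsPairing κ)
    (j : {j : β // JoinIrred j}) : ¬ j.1 ≤ (κ j).1 := by
  intro h
  obtain ⟨z, hz, _⟩ := j.2
  have h1 : j.1 ⊓ (κ j).1 = z := (hκ.2.1 j z hz).1
  rw [inf_eq_left.mpr h] at h1
  exact hz.lt.ne h1.symm

/-- formulas for rowmotion, its inverse, and the pop-stack sorting
operators on a semidistrim lattice: `Row(x) = ⋀ κ(D(x))`, `Row⁻¹(x) = ⋁ U(x)`,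
`Pop↓(x) = x ⊓ ⋀ κ(D(x)) = x ⊓ Row(x)` and `Pop↑(x) = x ⊔ ⋁ U(x) = x ⊔ Row⁻¹(x)`. -/
theorem stmt17 {α : Type u} [CompleteLattice α] [Finite α]
    (hsd : Semidistrim α)
    (κ : {j : α // JoinIrred j} → {m : α // MeetIrred m})
    (hκ : IsPairing κ) (huniq : ∀ κ', IsPairing κ' → κ' = κ)
    (Row RowInv : α → α)
    (hRow : ∀ x : α, ULabel κ (Row x) = DLabel κ x)
    (hInv1 : Function.LeftInverse RowInv Row)
    (hInv2 : Function.RightInverse RowInv Row)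
    (x : α) :
    Row x = sInf ((fun j : {j : α // JoinIrred j} => (κ j).1) '' DLabel κ x) ∧
    RowInv x = sSup ((fun j : {j : α // JoinIrred j} => j.1) '' ULabel κ x) ∧
    PopDown x = x ⊓ sInf ((fun j : {j : α // JoinIrred j} => (κ j).1) '' DLabel κ x) ∧
    PopUp x = x ⊔ sSup ((fun j : {j : α // JoinIrred j} => j.1) '' ULabel κ x) ∧
    PopDown x = x ⊓ Row x ∧
    PopUp x = x ⊔ RowInv x := by
  have lab := exists_label hsd.1 κ hκ
  have nle := not_le_kappa hκ
  have hD : ∀ x : α, x = sSup ((fun j : {j : α // JoinIrred j} => j.1) '' DLabel κ x) := by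
    intro x
    have hle : sSup ((fun j : {j : α // JoinIrred j} => j.1) '' DLabel κ x) ≤ x := by
      apply sSup_le
      rintro _ ⟨j, ⟨y, _, h, _⟩, rfl⟩
      exact h
    by_contra hne
    obtain ⟨y, h1, h2⟩ := exists_le_covBy_of_lt (lt_of_le_of_ne hle (Ne.symm hne))
    obtain ⟨j, h3, h4⟩ := lab y x h2
    have hm : j.1 ∈ (fun j : {j : α // JoinIrred j} => j.1) '' DLabel κ x := ⟨j, ⟨y, h2, h3, h4⟩, rfl⟩
    exact nle j ((le_sSup hm).trans (h1.trans h4))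
  have hU : ∀ x : α, x = sInf ((fun j : {j : α // JoinIrred j} => (κ j).1) '' ULabel κ x) := by
    intro x
    have hle : x ≤ sInf ((fun j : {j : α // JoinIrred j} => (κ j).1) '' ULabel κ x) := by
      apply le_sInf
      rintro _ ⟨j, ⟨y, _, _, h⟩, rfl⟩
      exact h
    by_contra hne
    obtain ⟨y, h2, h1⟩ := exists_covBy_le_of_lt (lt_of_le_of_ne hle hne)
    obtain ⟨j, h3, h4⟩ := lab x y h2
    exact nle j (h3.trans (h1.trans (sInf_le ⟨j, ⟨y, h2, h3, h4⟩, rfl⟩)))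
  have c1 : Row x = sInf ((fun j : {j : α // JoinIrred j} => (κ j).1) '' DLabel κ x) := by
    rw [← hRow x]; exact hU _
  have c2 : RowInv x = sSup ((fun j : {j : α // JoinIrred j} => j.1) '' ULabel κ x) := by
    have h := hRow (RowInv x)
    rw [hInv2 x] at h
    rw [h]; exact hD _
  have c3 : PopDown x =
      x ⊓ sInf ((fun j : {j : α // JoinIrred j} => (κ j).1) '' DLabel κ x) := by
    apply le_antisymm
    · refine le_inf inf_le_left (le_sInf ?_)
      rintro _ ⟨j, ⟨y, h1, _, h2⟩, rfl⟩
      exact inf_le_right.trans ((sInf_le (show y ∈ {y : α | y ⋖ x} from h1)).trans h2)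
    · refine le_inf inf_le_left (le_sInf ?_)
      intro y hy
      obtain ⟨j, h3, h4⟩ := lab y x hy
      have h5 : y = x ⊓ (κ j).1 := by
        refine (eq_or_lt_of_le (le_inf hy.le h4)).resolve_right fun h => ?_
        exact hy.2 h (lt_of_le_of_ne inf_le_left fun e =>
          nle j (h3.trans (inf_eq_left.mp e)))
      have hm : (κ j).1 ∈ (fun j : {j : α // JoinIrred j} => (κ j).1) '' DLabel κ x := ⟨j, ⟨y, hy, h3, h4⟩, rfl⟩
      exact (inf_le_inf_left x (sInf_le hm)).trans h5.ge
  have c4 : PopUp x = x ⊔ sSup ((fun j : {j : α // JoinIrred j} => j.1) '' ULabel κ x) := by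
    apply le_antisymm
    · refine sup_le le_sup_left (sSup_le ?_)
      intro y hy
      obtain ⟨j, h3, h4⟩ := lab x y hy
      have h5 : x ⊔ j.1 = y := by
        refine (eq_or_lt_of_le (sup_le hy.le h3)).resolve_right fun h => ?_
        exact hy.2 (lt_of_le_of_ne le_sup_left fun e =>
          nle j ((sup_eq_left.mp e.symm).trans h4)) h
      have hm : j.1 ∈ (fun j : {j : α // JoinIrred j} => j.1) '' ULabel κ x := ⟨j, ⟨y, hy, h3, h4⟩, rfl⟩
      exact h5.ge.trans (sup_le_sup_left (le_sSup hm) x)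
    · refine sup_le le_sup_left (sSup_le ?_)
      rintro _ ⟨j, ⟨y, h1, h2, _⟩, rfl⟩
      exact h2.trans ((le_sSup (show y ∈ {y : α | x ⋖ y} from h1)).trans le_sup_right)
  exact ⟨c1, c2, c3, c4, by rw [c3, c1], by rw [c4, c2]⟩
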